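/- The Hamiltonian map D_H satisfies [D_H(f), D_H(g)] = D_H(D_H(f)(g)) for all homogeneous f, g ∈ O(m,n), where the left side is the super bracket of superderivations. -/

import Mathlib

open Finsupp Finset

namespace HamSup

variable (F : Type) [Field F]

/-- Monomial index: a multi-exponent for the divided power part and a set of odd indices. -/
abbrev Mono (m n : ℕ) := (Fin m → ℕ) × Finset (Fin n)

/-- The superalgebra `O(m,n)` as the free module on monomials `x^(α) x^u`. -/
abbrev O (m n : ℕ) := Mono m n →₀ F

variable {m n : ℕ}

/-- The basis monomial `x^(α) x^u`. -/
noncomputable def X (μ : Mono m n) : O F m n := Finsupp.single μ 1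

/-- Linear extension of a map defined on basis monomials. -/
noncomputable def extend {N : Type} [AddCommGroup N] [Module F N]
    (v : Mono m n → N) : O F m n →ₗ[F] N :=
  Finsupp.lsum F fun μ => LinearMap.toSpanSingleton F N (v μ)

/-- Number of inversions when concatenating `x^u` and `x^v`. -/
def invCount (u v : Finset (Fin n)) : ℕ :=
  ((u ×ˢ v).filter fun q => q.2 < q.1).card

/-- Product of two basis monomials: divided-power binomial coefficients on the even part and
a sign (with nilpotency) on the exterior part. -/
noncomputable def mulMono (μ ν : Mono m n) : O F m n :=
  if Disjoint μ.2 ν.2 then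
    (((-1 : F) ^ invCount μ.2 ν.2) * ∏ i, ((μ.1 i + ν.1 i).choose (μ.1 i) : F)) •
      X F (μ.1 + ν.1, μ.2 ∪ ν.2)
  else 0

/-- The multiplication of `O(m,n)` as a bilinear map. -/
noncomputable def mulO : O F m n →ₗ[F] O F m n →ₗ[F] O F m n :=
  extend F fun μ => extend F (mulMono F μ)

/-- Even partial derivative `∂_i`, `i ∈ I₀`. -/
noncomputable def pdE (i : Fin m) : O F m n →ₗ[F] O F m n :=
  extend F fun μ =>
    if μ.1 i = 0 then 0 else X F (Function.update μ.1 i (μ.1 i - 1), μ.2)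

/-- Odd partial derivative `∂_j`, `j ∈ I₁`. -/
noncomputable def pdO (j : Fin n) : O F m n →ₗ[F] O F m n :=
  extend F fun μ =>
    if j ∈ μ.2 then ((-1 : F) ^ (μ.2.filter fun k => k < j).card) • X F (μ.1, μ.2.erase j)
    else 0

/-- Partial derivative indexed by `I = I₀ ⊔ I₁`. -/
noncomputable def pd (i : Fin m ⊕ Fin n) : O F m n →ₗ[F] O F m n :=
  Sum.elim (pdE F) (pdO F) i

/-- Parity `μ(i)` of an index. -/
def idxPar : Fin m ⊕ Fin n → ℕ := Sum.elim (fun _ => 0) (fun _ => 1)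

/-- The sign `τ(i)`. -/
def tau (r : ℕ) : Fin m ⊕ Fin n → ℤ :=
  Sum.elim (fun i => if (i : ℕ) < r then 1 else -1) (fun _ => 1)

/-- The basis vector field `x^(α) x^u ∂_i` of the Witt superalgebra, as an endomorphism. -/
noncomputable def fD (μ : Mono m n) (i : Fin m ⊕ Fin n) : Module.End F (O F m n) :=
  (mulO F (X F μ)).comp (pd F i)

/-- `D_H(x^(α)x^u) = Σ_i τ(i)(−1)^{μ(i)p(f)} ∂_i(f) ∂_{i'}` on a basis monomial. -/
noncomputable def DHmono (r : ℕ) (pr : Fin m ⊕ Fin n → Fin m ⊕ Fin n) (μ : Mono m n) :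
    Module.End F (O F m n) :=
  ∑ i : Fin m ⊕ Fin n,
    (((tau r i : ℤ) : F) * (-1 : F) ^ (idxPar i * μ.2.card)) •
      ((mulO F (pd F i (X F μ))).comp (pd F (pr i)))

/-- The Hamiltonian map `D_H` as a linear map. -/
noncomputable def DH (r : ℕ) (pr : Fin m ⊕ Fin n → Fin m ⊕ Fin n) :
    O F m n →ₗ[F] Module.End F (O F m n) :=
  extend F (DHmono F r pr)

/-- Truncation condition `α ∈ A(m;t)`, i.e. `α_i ≤ π_i = p^{t_i} − 1`. -/
def inA (p : ℕ) (t : Fin m → ℕ) (α : Fin m → ℕ) : Prop := ∀ i, α i < p ^ t i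

/-- The tuple `π`. -/
def piF (p : ℕ) (t : Fin m → ℕ) : Fin m → ℕ := fun i => p ^ t i - 1

/-- The truncated algebra `O(m,n;t)` as a subspace. -/
noncomputable def Ot (p : ℕ) (t : Fin m → ℕ) : Submodule F (O F m n) :=
  Submodule.span F {x | ∃ μ : Mono m n, inA p t μ.1 ∧ x = X F μ}

/-- The even part `H₀̄` of the Hamiltonian superalgebra. -/
noncomputable def H0 (p r : ℕ) (t : Fin m → ℕ) (pr : Fin m ⊕ Fin n → Fin m ⊕ Fin n) :
    Submodule F (Module.End F (O F m n)) :=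
  Submodule.span F {x | ∃ μ : Mono m n, inA p t μ.1 ∧ Even μ.2.card ∧
    ¬(μ.1 = piF p t ∧ μ.2 = Finset.univ) ∧ x = DHmono F r pr μ}

/-- The codimension-one ideal `J` of `H₀̄`. -/
noncomputable def Jid (p r : ℕ) (t : Fin m → ℕ) (pr : Fin m ⊕ Fin n → Fin m ⊕ Fin n) :
    Submodule F (Module.End F (O F m n)) :=
  Submodule.span F {x | ∃ μ : Mono m n, inA p t μ.1 ∧ Even μ.2.card ∧
    ¬(μ.1 = piF p t ∧ μ.2 = Finset.univ) ∧ ¬(μ.1 = piF p t ∧ μ.2 = ∅) ∧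
    x = DHmono F r pr μ}

/-- The odd part `W₁̄` of the Witt superalgebra `W(m,n;t)`. -/
noncomputable def W1 (p : ℕ) (t : Fin m → ℕ) : Submodule F (Module.End F (O F m n)) :=
  Submodule.span F {x | ∃ (μ : Mono m n) (i : Fin m ⊕ Fin n), inA p t μ.1 ∧
    Odd (μ.2.card + idxPar i) ∧ x = fD F μ i}

/-- The `ℤ`-degree-`k` component of `W(m,n;t)`. -/
noncomputable def Wcomp (p : ℕ) (t : Fin m → ℕ) (k : ℤ) :
    Submodule F (Module.End F (O F m n)) :=
  Submodule.span F {x | ∃ (μ : Mono m n) (i : Fin m ⊕ Fin n), inA p t μ.1 ∧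
    (((∑ l, μ.1 l : ℕ) : ℤ) + (μ.2.card : ℤ)) - 1 = k ∧ x = fD F μ i}

/-- The iterated adjoint action `(ad D)^k (E)`. -/
noncomputable def adIter (D : Module.End F (O F m n)) (k : ℕ)
    (E : Module.End F (O F m n)) : Module.End F (O F m n) :=
  (fun E => D * E - E * D)^[k] E

end HamSup

namespace HamSup
section Aux
variable {F : Type} [Field F] {m n : ℕ}

theorem extend_X {N : Type} [AddCommGroup N] [Module F N] (v : Mono m n → N) (μ : Mono m n) :
    extend F v (X F μ) = v μ := by
  simp [extend, X]

theorem lin_ext {N : Type} [AddCommGroup N] [Module F N] {f g : O F m n →ₗ[F] N}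
    (h : ∀ μ, f (X F μ) = g (X F μ)) : f = g := by
  apply Finsupp.lhom_ext'
  intro μ
  apply LinearMap.ext_ring
  simpa [X] using h μ

theorem mulO_X (μ ν : Mono m n) : mulO F (X F μ) (X F ν) = mulMono F μ ν := by
  simp [mulO, extend_X]

theorem pdE_X (i : Fin m) (μ : Mono m n) : pdE F i (X F μ) =
    if μ.1 i = 0 then 0 else X F (Function.update μ.1 i (μ.1 i - 1), μ.2) := by
  simp only [pdE, extend_X]

theorem pdO_X (j : Fin n) (μ : Mono m n) : pdO F j (X F μ) =
    if j ∈ μ.2 then ((-1 : F) ^ (μ.2.filter fun k => k < j).card) • X F (μ.1, μ.2.erase j)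
    else 0 := by
  simp only [pdO, extend_X]

/-! inversion counts -/

theorem invCount_eq_left (u v : Finset (Fin n)) :
    invCount u v = ∑ a ∈ u, (v.filter fun k => k < a).card := by
  unfold invCount
  rw [Finset.card_filter, Finset.sum_product]
  simp only [Finset.card_filter]

theorem invCount_eq_right (u v : Finset (Fin n)) :
    invCount u v = ∑ b ∈ v, (u.filter fun k => b < k).card := by
  unfold invCount
  rw [Finset.card_filter, Finset.sum_product_right]
  simp only [Finset.card_filter]

theorem invCount_union_left {u v : Finset (Fin n)} (w : Finset (Fin n)) (h : Disjoint u v) :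
    invCount (u ∪ v) w = invCount u w + invCount v w := by
  simp only [invCount_eq_left, Finset.sum_union h]

theorem invCount_union_right {u v : Finset (Fin n)} (w : Finset (Fin n)) (h : Disjoint u v) :
    invCount w (u ∪ v) = invCount w u + invCount w v := by
  simp only [invCount_eq_right, Finset.sum_union h]

theorem invCount_erase_left {u : Finset (Fin n)} (v : Finset (Fin n)) {j : Fin n} (h : j ∈ u) :
    invCount u v = (v.filter fun k => k < j).card + invCount (u.erase j) v := by
  simp only [invCount_eq_left]
  rw [Finset.add_sum_erase _ (fun a => (v.filter fun k => k < a).card) h]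

theorem invCount_erase_right (u : Finset (Fin n)) {v : Finset (Fin n)} {j : Fin n} (h : j ∈ v) :
    invCount u v = (u.filter fun k => j < k).card + invCount u (v.erase j) := by
  simp only [invCount_eq_right]
  rw [Finset.add_sum_erase _ (fun b => (u.filter fun k => b < k).card) h]

theorem invCount_swap {u v : Finset (Fin n)} (h : Disjoint u v) :
    invCount u v + invCount v u = u.card * v.card := by
  rw [invCount_eq_left, invCount_eq_right v u, ← Finset.sum_add_distrib]
  rw [Finset.sum_congr rfl (g := fun _ => v.card), Finset.sum_const, smul_eq_mul]
  intro a ha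
  rw [← Finset.card_union_of_disjoint]
  · congr 1
    ext k
    simp only [Finset.mem_union, Finset.mem_filter]
    have : k ∈ v → k ≠ a := fun hk e => Finset.disjoint_left.1 h ha (e ▸ hk)
    grind
  · rw [Finset.disjoint_left]; grind

theorem card_lt_gt_not_mem {u : Finset (Fin n)} {j : Fin n} (h : j ∉ u) :
    (u.filter fun k => k < j).card + (u.filter fun k => j < k).card = u.card := by
  rw [← Finset.card_union_of_disjoint]
  · congr 1
    ext k
    simp only [Finset.mem_union, Finset.mem_filter]
    have : k ∈ u → k ≠ j := fun hk e => h (e ▸ hk)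
    grind
  · rw [Finset.disjoint_left]; grind

theorem card_lt_gt_mem {u : Finset (Fin n)} {j : Fin n} (h : j ∈ u) :
    (u.filter fun k => k < j).card + (u.filter fun k => j < k).card + 1 = u.card := by
  have h1 := card_lt_gt_not_mem (Finset.notMem_erase j u)
  rw [← Finset.card_erase_add_one h, ← h1]
  congr 3 <;> ext k <;> simp only [Finset.mem_filter, Finset.mem_erase] <;> grind

/-! associativity -/

theorem choose_assoc (a b c : ℕ) :
    (a + b).choose a * (a + b + c).choose (a + b) = (b + c).choose b * (a + (b + c)).choose a := by
  have h := Nat.choose_mul (n := a + b + c) (k := a + b) (s := a) (by omega)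
  rw [show a + b + c - a = b + c by omega, show a + b - a = b by omega] at h
  rw [← add_assoc, mul_comm, h, mul_comm]

theorem mul_assoc_X (μ ν ρ : Mono m n) :
    mulO F (mulO F (X F μ) (X F ν)) (X F ρ) = mulO F (X F μ) (mulO F (X F ν) (X F ρ)) := by
  obtain ⟨a, u⟩ := μ
  obtain ⟨b, v⟩ := ν
  obtain ⟨c, w⟩ := ρ
  simp only [mulO_X, mulMono]
  by_cases huv : Disjoint u v <;> by_cases huw : Disjoint u w <;> by_cases hvw : Disjoint v w <;>
    simp [huv, hvw, huw, mulO_X, mulMono, Finset.disjoint_union_left, Finset.disjoint_union_right]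
  rw [smul_smul, smul_smul, add_assoc a b c, invCount_union_left _ huv,
    invCount_union_right _ hvw]
  congr 1
  have : (∏ i, ((a i + b i).choose (a i) : F)) * (∏ i, ((a i + b i + c i).choose (a i + b i) : F))
      = (∏ i, ((b i + c i).choose (b i) : F)) * (∏ i, ((a i + (b i + c i)).choose (a i) : F)) := by
    rw [← Finset.prod_mul_distrib, ← Finset.prod_mul_distrib]
    refine Finset.prod_congr rfl fun i _ => ?_
    exact_mod_cast congrArg (Nat.cast (R := F)) (choose_assoc (a i) (b i) (c i))
  simp only [pow_add]
  linear_combination (-1 : F) ^ invCount u v * ((-1) ^ invCount u w * (-1) ^ invCount v w) * this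

theorem mul_assoc_O (a b c : O F m n) :
    mulO F (mulO F a b) c = mulO F a (mulO F b c) := by
  have h : (mulO F).compr₂ (mulO F) =
      ((LinearMap.llcomp F (O F m n) (O F m n) (O F m n)).comp (mulO F)).compl₂ (mulO F)
      := by
    refine lin_ext fun μ => lin_ext fun ν => lin_ext fun ρ => ?_
    simpa using mul_assoc_X μ ν ρ
  have := LinearMap.congr_fun (LinearMap.congr_fun (LinearMap.congr_fun h a) b) c
  simpa using this

/-- Elements of parity `a`. -/
noncomputable def Hm (F : Type) [Field F] (m n : ℕ) (a : ℕ) : Submodule F (O F m n) :=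
  Submodule.span F {x | ∃ μ : Mono m n, Even (μ.2.card + a) ∧ x = X F μ}

theorem X_mem {μ : Mono m n} {a : ℕ} (h : Even (μ.2.card + a)) : X F μ ∈ Hm F m n a :=
  Submodule.subset_span ⟨μ, h, rfl⟩

theorem X_mem_self (μ : Mono m n) : X F μ ∈ Hm F m n μ.2.card := X_mem (by simp)

theorem Hm_ind {N : Type} [AddCommGroup N] [Module F N] {a : ℕ} {f g : O F m n →ₗ[F] N}
    (h : ∀ μ : Mono m n, Even (μ.2.card + a) → f (X F μ) = g (X F μ)) {x : O F m n}
    (hx : x ∈ Hm F m n a) : f x = g x := by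
  refine LinearMap.eqOn_span (R := F) ?_ hx
  rintro _ ⟨μ, hμ, rfl⟩
  exact h μ hμ

theorem Hm_mem {a b : ℕ} {f : O F m n →ₗ[F] O F m n}
    (h : ∀ μ : Mono m n, Even (μ.2.card + a) → f (X F μ) ∈ Hm F m n b) {x : O F m n}
    (hx : x ∈ Hm F m n a) : f x ∈ Hm F m n b := by
  have : Hm F m n a ≤ (Hm F m n b).comap f := by
    refine Submodule.span_le.2 ?_
    rintro _ ⟨μ, hμ, rfl⟩
    exact h μ hμ
  exact this hx

theorem neg_pow_congr {a b : ℕ} (h : Even (a + b)) : (-1 : F) ^ a = (-1) ^ b := by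
  rcases Nat.even_or_odd a with ha | ha <;> rcases Nat.even_or_odd b with hb | hb <;>
    simp [ha.neg_one_pow, hb.neg_one_pow] <;> grind

theorem neg_pow_succ_aux (a : ℕ) : -(-1 : F) ^ a = (-1) ^ (a + 1) := by ring

theorem supercomm_X (μ ν : Mono m n) :
    mulO F (X F μ) (X F ν) = (-1 : F) ^ (μ.2.card * ν.2.card) • mulO F (X F ν) (X F μ) := by
  simp only [mulO_X, mulMono]
  by_cases h : Disjoint μ.2 ν.2
  · rw [if_pos h, if_pos h.symm, smul_smul, add_comm, union_comm, ← mul_assoc, ← pow_add,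
      ← invCount_swap h]
    congr 2
    · apply neg_pow_congr; grind
    · refine Finset.prod_congr rfl fun i _ => ?_
      rw [add_comm (ν.1 i), Nat.choose_symm_add]
  · rw [if_neg h, if_neg (fun k => h k.symm), smul_zero]

theorem supercomm {a b : ℕ} {x y : O F m n} (hx : x ∈ Hm F m n a) (hy : y ∈ Hm F m n b) :
    mulO F x y = (-1 : F) ^ (a * b) • mulO F y x := by
  have := Hm_ind (f := (mulO F).flip y) (g := (-1 : F) ^ (a * b) • mulO F y) (a := a) ?_ hx
  · simpa using this
  intro μ hμ
  have := Hm_ind (f := mulO F (X F μ)) (g := (-1 : F) ^ (a * b) • (mulO F).flip (X F μ)) (a := b)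
    ?_ hy
  · simpa using this
  intro ν hν
  rw [supercomm_X, LinearMap.smul_apply, LinearMap.flip_apply, neg_pow_congr]
  rw [Nat.even_add] at *
  simp only [Nat.even_mul]; grind

theorem mul_mem {a b : ℕ} {x y : O F m n} (hx : x ∈ Hm F m n a) (hy : y ∈ Hm F m n b) :
    mulO F x y ∈ Hm F m n (a + b) := by
  refine Hm_mem (f := (mulO F).flip y) (a := a) ?_ hx
  intro μ hμ
  refine Hm_mem (f := mulO F (X F μ)) (a := b) ?_ hy
  intro ν hν
  rw [mulO_X, mulMono]
  split_ifs with h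
  · refine Submodule.smul_mem _ _ (X_mem ?_)
    simp only [Finset.card_union_of_disjoint h]
    grind
  · exact Submodule.zero_mem _

theorem pd_mem {a : ℕ} {x : O F m n} (i : Fin m ⊕ Fin n) (hx : x ∈ Hm F m n a) :
    pd F i x ∈ Hm F m n (a + idxPar i) := by
  refine Hm_mem (f := pd F i) (a := a) ?_ hx
  intro μ hμ
  rcases i with i | j
  · simp only [pd, Sum.elim_inl, idxPar, pdE_X]
    split_ifs
    · exact Submodule.zero_mem _
    · exact X_mem (by simpa using hμ)
  · simp only [pd, Sum.elim_inr, idxPar, pdO_X]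
    split_ifs with h
    · refine Submodule.smul_mem _ _ (X_mem ?_)
      have := Finset.card_erase_add_one h
      simp only
      grind
    · exact Submodule.zero_mem _


/-! Leibniz rule -/

theorem leibE_X (i : Fin m) (μ ν : Mono m n) :
    pdE F i (mulO F (X F μ) (X F ν)) =
      mulO F (pdE F i (X F μ)) (X F ν) + mulO F (X F μ) (pdE F i (X F ν)) := by
  obtain ⟨a, u⟩ := μ
  obtain ⟨b, v⟩ := ν
  by_cases h : Disjoint u v
  swap
  · simp only [mulO_X, mulMono, pdE_X]
    split_ifs <;> simp [mulO_X, mulMono, h]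
  have key : ∀ a b : Fin m → ℕ, (∏ l, ((a l + b l).choose (a l) : F)) =
      ((a i + b i).choose (a i) : F) * ∏ l ∈ univ.erase i, ((a l + b l).choose (a l) : F) :=
    fun a b => (Finset.mul_prod_erase _ _ (mem_univ i)).symm
  have e1 : ∀ x, ∏ l ∈ univ.erase i,
      ((Function.update a i x l + b l).choose (Function.update a i x l) : F) =
      ∏ l ∈ univ.erase i, ((a l + b l).choose (a l) : F) := fun x => by
    refine Finset.prod_congr rfl fun l hl => ?_
    rw [Function.update_of_ne (Finset.ne_of_mem_erase hl)]
  have e2 : ∀ x, ∏ l ∈ univ.erase i, ((a l + Function.update b i x l).choose (a l) : F) =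
      ∏ l ∈ univ.erase i, ((a l + b l).choose (a l) : F) := fun x => by
    refine Finset.prod_congr rfl fun l hl => ?_
    rw [Function.update_of_ne (Finset.ne_of_mem_erase hl)]
  have f1 : a i ≠ 0 → Function.update a i (a i - 1) + b
      = Function.update (a + b) i (a i + b i - 1) := fun ha => by
    funext l
    by_cases hl : l = i
    · subst hl; simp; omega
    · simp [hl]
  have f2 : b i ≠ 0 → a + Function.update b i (b i - 1)
      = Function.update (a + b) i (a i + b i - 1) := fun hb => by
    funext l
    by_cases hl : l = i
    · subst hl; simp; omega
    · simp [hl]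
  rcases Nat.eq_zero_or_pos (a i) with ha | ha <;> rcases Nat.eq_zero_or_pos (b i) with hb | hb
  · simp [mulO_X, mulMono, h, pdE_X, ha, hb]
  · have hb' : b i ≠ 0 := by omega
    have := f2 hb'
    simp only [mulO_X, mulMono, h, pdE_X, ha, hb', if_true, if_false, map_smul, Pi.add_apply,
      key, e1, e2, f2 hb']
    simp [ha, hb', key, e2]
  · have ha' : a i ≠ 0 := by omega
    simp only [mulO_X, mulMono, h, pdE_X, hb, ha', if_true, if_false, map_smul, Pi.add_apply,
      key, e1, e2, f1 ha']
    simp [hb, ha', key, e1]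
  · have hb' : b i ≠ 0 := by omega
    have ha' : a i ≠ 0 := by omega
    have hab : a i + b i ≠ 0 := by omega
    simp only [mulO_X, mulMono, h, pdE_X, hb', ha', hab, if_true, if_false, map_smul, Pi.add_apply,
      key, e1, e2, f1 ha', f2 hb']
    rw [← add_smul]
    congr 1
    simp only [Function.update_self]
    obtain ⟨x, hx⟩ := Nat.exists_eq_succ_of_ne_zero ha'
    obtain ⟨y, hy⟩ := Nat.exists_eq_succ_of_ne_zero hb'
    have := congrArg (Nat.cast (R := F)) (Nat.choose_succ_succ (x + y + 1) x)
    rw [hx, hy]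
    have h1 : x.succ + y.succ = (x + y + 1).succ := by omega
    have h2 : x.succ - 1 + y.succ = x + y + 1 := by omega
    have h3 : x.succ + (y.succ - 1) = x + y + 1 := by omega
    rw [h1, h2, h3]
    push_cast at this ⊢
    linear_combination (-1) ^ invCount u v *
      (∏ l ∈ univ.erase i, ((a l + b l).choose (a l) : F)) * this

theorem filter_union_card {u v : Finset (Fin n)} (h : Disjoint u v) (j : Fin n) :
    ((u ∪ v).filter fun k => k < j).card =
      (u.filter fun k => k < j).card + (v.filter fun k => k < j).card := by
  rw [Finset.filter_union, Finset.card_union_of_disjoint (Finset.disjoint_filter_filter h)]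

theorem leibO_X (j : Fin n) (μ ν : Mono m n) :
    pdO F j (mulO F (X F μ) (X F ν)) =
      mulO F (pdO F j (X F μ)) (X F ν) +
        (-1 : F) ^ μ.2.card • mulO F (X F μ) (pdO F j (X F ν)) := by
  obtain ⟨a, u⟩ := μ
  obtain ⟨b, v⟩ := ν
  by_cases hu : j ∈ u <;> by_cases hv : j ∈ v
  · have h : ¬ Disjoint u v := fun h => Finset.disjoint_left.1 h hu hv
    have hd : Disjoint (u.erase j) v ↔ Disjoint u (v.erase j) := by
      simp only [Finset.disjoint_left, Finset.mem_erase]; grind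
    by_cases hd' : Disjoint u (v.erase j)
    · have h1 := hd.2 hd'
      have e1 : u.erase j ∪ v = u ∪ v := by ext k; simp; grind
      have e2 : u ∪ v.erase j = u ∪ v := by ext k; simp; grind
      simp only [mulO_X, mulMono, h, pdO_X, hu, hv, h1, hd', if_true, if_false, map_smul, map_zero,
        LinearMap.smul_apply, e1, e2, smul_smul]
      rw [← add_smul]
      symm
      convert zero_smul F _ 
      have i1 := invCount_erase_right (u.erase j) hv
      have i2 := invCount_erase_left (v.erase j) hu
      have i3 := card_lt_gt_mem hu
      have g1 : ((u.erase j).filter fun k => j < k) = u.filter fun k => j < k := by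
        ext k; simp; grind
      have g2 : ((v.erase j).filter fun k => k < j) = v.filter fun k => k < j := by
        ext k; simp; grind
      rw [g1] at i1
      rw [g2] at i2
      have : (-1 : F) ^ u.card * ((-1) ^ (v.filter fun k => k < j).card * (-1) ^ invCount u (v.erase j))
          = - ((-1) ^ (u.filter fun k => k < j).card * (-1) ^ invCount (u.erase j) v) := by
        rw [← pow_add, ← pow_add, ← pow_add, neg_pow_succ_aux]
        apply neg_pow_congr
        grind
      linear_combination (∏ i, ((a i + b i).choose (a i) : F)) * this
    · have h1 : ¬ Disjoint (u.erase j) v := fun k => hd' (hd.1 k)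
      simp [mulO_X, mulMono, h, pdO_X, hu, hv, h1, hd']
  · by_cases h : Disjoint u v
    · have h1 : Disjoint (u.erase j) v := h.mono_left (Finset.erase_subset _ _)
      have e1 : u.erase j ∪ v = (u ∪ v).erase j := by ext k; simp; grind
      have hm : j ∈ u ∪ v := by simp [hu]
      simp only [mulO_X, mulMono, h, pdO_X, hu, hv, h1, hm, if_true, if_false, map_smul, map_zero,
        LinearMap.smul_apply, e1, smul_smul, smul_zero, add_zero]
      congr 1
      have i2 := invCount_erase_left v hu
      have : (-1 : F) ^ invCount u v * (-1) ^ ((u ∪ v).filter fun k => k < j).card =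
          (-1) ^ (u.filter fun k => k < j).card * (-1) ^ invCount (u.erase j) v := by
        rw [← pow_add, ← pow_add]
        apply neg_pow_congr
        rw [filter_union_card h, i2]
        grind
      linear_combination (∏ i, ((a i + b i).choose (a i) : F)) * this
    · have h1 : ¬ Disjoint (u.erase j) v := by
        rw [Finset.disjoint_left] at *; simp only [Finset.mem_erase]; grind
      simp [mulO_X, mulMono, h, pdO_X, hu, hv, h1]
  · by_cases h : Disjoint u v
    · have h1 : Disjoint u (v.erase j) := h.mono_right (Finset.erase_subset _ _)
      have e1 : u ∪ v.erase j = (u ∪ v).erase j := by ext k; simp; grind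
      have hm : j ∈ u ∪ v := by simp [hv]
      simp only [mulO_X, mulMono, h, pdO_X, hu, hv, h1, hm, if_true, if_false, map_smul, map_zero,
        LinearMap.smul_apply, LinearMap.zero_apply, e1, smul_smul, smul_zero, zero_add]
      congr 1
      have i2 := invCount_erase_right u hv
      have i3 := card_lt_gt_not_mem hu
      have : (-1 : F) ^ invCount u v * (-1) ^ ((u ∪ v).filter fun k => k < j).card =
          (-1) ^ u.card * ((-1) ^ (v.filter fun k => k < j).card *
            (-1) ^ invCount u (v.erase j)) := by
        rw [← pow_add, ← pow_add, ← pow_add]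
        apply neg_pow_congr
        rw [filter_union_card h, i2]
        grind
      linear_combination (∏ i, ((a i + b i).choose (a i) : F)) * this
    · have h1 : ¬ Disjoint u (v.erase j) := by
        rw [Finset.disjoint_left] at *; simp only [Finset.mem_erase]; grind
      simp [mulO_X, mulMono, h, pdO_X, hu, hv, h1]
  · by_cases h : Disjoint u v <;> simp [mulO_X, mulMono, h, pdO_X, hu, hv]

theorem leib {a : ℕ} (i : Fin m ⊕ Fin n) {x : O F m n} (hx : x ∈ Hm F m n a) (y : O F m n) :
    pd F i (mulO F x y) =
      mulO F (pd F i x) y + (-1 : F) ^ (idxPar i * a) • mulO F x (pd F i y) := by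
  have := Hm_ind (N := O F m n →ₗ[F] O F m n) (f := (mulO F).compr₂ (pd F i))
    (g := (mulO F).comp (pd F i) + (-1 : F) ^ (idxPar i * a) • (mulO F).compl₂ (pd F i))
    (a := a) ?_ hx
  · simpa using LinearMap.congr_fun this y
  intro μ hμ
  refine lin_ext fun ν => ?_
  rcases i with i | j
  · simpa [pd, idxPar] using leibE_X i μ ν
  · have := leibO_X (F := F) j μ ν
    rw [neg_pow_congr hμ] at this
    simpa [pd, idxPar] using this

/-! commutation of partial derivatives -/

theorem filter_erase_card {u : Finset (Fin n)} {j : Fin n} (hj : j ∈ u) (k : Fin n) :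
    (u.filter fun l => l < k).card =
      ((u.erase j).filter fun l => l < k).card + if j < k then 1 else 0 := by
  split_ifs with h
  · rw [← Finset.card_erase_add_one (s := u.filter fun l => l < k) (a := j) (by simp [hj, h]),
      ← Finset.filter_erase]
  · rw [add_zero]
    congr 1
    ext l; simp; grind

theorem pd_comm_X (i j : Fin m ⊕ Fin n) (μ : Mono m n) :
    pd F i (pd F j (X F μ)) = (-1 : F) ^ (idxPar i * idxPar j) • pd F j (pd F i (X F μ)) := by
  obtain ⟨a, u⟩ := μ
  rcases i with i | i <;> rcases j with j | j
  · simp only [pd, idxPar, Sum.elim_inl, pdE_X, mul_zero, pow_zero, one_smul]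
    by_cases hij : i = j
    · subst hij; rfl
    · have hji := Ne.symm hij
      by_cases hi : a i = 0 <;> by_cases hj : a j = 0 <;>
        simp [hi, hj, hij, hji, pdE_X, Function.update_comm hij]
  · simp only [pd, idxPar, Sum.elim_inl, Sum.elim_inr, pdE_X, pdO_X, zero_mul, pow_zero, one_smul]
    by_cases hi : a i = 0 <;> by_cases hj : j ∈ u <;> simp [hi, hj, pdE_X, pdO_X]
  · simp only [pd, idxPar, Sum.elim_inl, Sum.elim_inr, pdE_X, pdO_X, mul_zero, pow_zero, one_smul]
    by_cases hi : i ∈ u <;> by_cases hj : a j = 0 <;> simp [hi, hj, pdE_X, pdO_X]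
  · simp only [pd, idxPar, Sum.elim_inr, pdO_X, mul_one, pow_one]
    by_cases hij : i = j
    · subst hij
      by_cases hi : i ∈ u <;> simp [hi, pdO_X]
    · have hji := Ne.symm hij
      by_cases hi : i ∈ u <;> by_cases hj : j ∈ u <;> simp [hi, hj, hij, hji, pdO_X]
      rw [smul_smul, smul_smul, ← neg_smul, Finset.erase_right_comm]
      congr 1
      rw [← pow_add, ← pow_add, neg_pow_succ_aux]
      apply neg_pow_congr
      have h1 := filter_erase_card hj i
      have h2 := filter_erase_card hi j
      rcases lt_or_gt_of_ne hij with h | h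
      · rw [if_neg (by omega)] at h1
        rw [if_pos h] at h2
        grind
      · rw [if_pos h] at h1
        rw [if_neg (by omega)] at h2
        grind

theorem pd_comm (i j : Fin m ⊕ Fin n) (x : O F m n) :
    pd F i (pd F j x) = (-1 : F) ^ (idxPar i * idxPar j) • pd F j (pd F i x) := by
  have : (pd F i).comp (pd F j) = (-1 : F) ^ (idxPar i * idxPar j) • (pd F j).comp (pd F i) :=
    lin_ext fun μ => by simpa using pd_comm_X i j μ
  simpa using LinearMap.congr_fun this x

/-! The Hamiltonian map on homogeneous elements -/

/-- The coefficient `τ(i) (-1)^{μ(i) a}`. -/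
noncomputable def cf (F : Type) [Field F] {m n : ℕ} (r a : ℕ) (i : Fin m ⊕ Fin n) : F :=
  ((tau r i : ℤ) : F) * (-1 : F) ^ (idxPar i * a)

theorem DH_hom (r : ℕ) (pr : Fin m ⊕ Fin n → Fin m ⊕ Fin n) {a : ℕ} {x : O F m n}
    (hx : x ∈ Hm F m n a) (h : O F m n) :
    DH F r pr x h = ∑ i, cf F r a i • mulO F (pd F i x) (pd F (pr i) h) := by
  have := Hm_ind (N := O F m n →ₗ[F] O F m n) (f := DH F r pr) (a := a)
    (g := ∑ i, cf F r a i • ((LinearMap.lcomp F (O F m n) (pd F (pr i))).comp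
      ((mulO F).comp (pd F i)))) ?_ hx
  · rw [this]; simp [LinearMap.sum_apply]
  intro μ hμ
  rw [DH, extend_X, DHmono]
  simp only [LinearMap.sum_apply, LinearMap.smul_apply]
  refine Finset.sum_congr rfl fun i _ => ?_
  rw [cf, neg_pow_congr (F := F) (a := idxPar i * μ.2.card) (b := idxPar i * a)]
  · rfl
  · rw [← mul_add]; exact hμ.mul_left _

theorem DHmono_eq (r : ℕ) (pr : Fin m ⊕ Fin n → Fin m ⊕ Fin n) (μ : Mono m n) (h : O F m n) :
    DHmono F r pr μ h =
      ∑ i, cf F r μ.2.card i • mulO F (pd F i (X F μ)) (pd F (pr i) h) := by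
  rw [← DH_hom r pr (X_mem_self μ), DH, extend_X]

variable (r : ℕ) (pr : Fin m ⊕ Fin n → Fin m ⊕ Fin n)

/-- First-order part of a product. -/
noncomputable def P1 (p q : ℕ) (f g h : O F m n) : O F m n :=
  ∑ i, ∑ j, (cf F r p i * cf F r q j) •
    mulO F (mulO F (pd F i f) (pd F (pr i) (pd F j g))) (pd F (pr j) h)

/-- Second-order part of a product. -/
noncomputable def P2 (p q : ℕ) (f g h : O F m n) : O F m n :=
  ∑ i, ∑ j, (cf F r p i * cf F r q j * (-1) ^ (idxPar i * (q + idxPar j))) •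
    mulO F (mulO F (pd F i f) (pd F j g)) (pd F (pr i) (pd F (pr j) h))

theorem prod_eq (hpar : ∀ i, idxPar (pr i) = idxPar i) {q : ℕ} (p : ℕ) (f : O F m n)
    {g : O F m n} (hg : g ∈ Hm F m n q) (h : O F m n) :
    ∑ i, cf F r p i • mulO F (pd F i f)
      (pd F (pr i) (∑ j, cf F r q j • mulO F (pd F j g) (pd F (pr j) h))) =
    P1 r pr p q f g h + P2 r pr p q f g h := by
  rw [P1, P2, ← Finset.sum_add_distrib]
  refine Finset.sum_congr rfl fun i _ => ?_
  rw [← Finset.sum_add_distrib, map_sum, map_sum, Finset.smul_sum]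
  refine Finset.sum_congr rfl fun j _ => ?_
  rw [map_smul, leib _ (pd_mem j hg), hpar]
  simp only [map_smul, map_add, smul_add, smul_smul, mul_assoc_O, mul_assoc]

theorem P2_symm (hpar : ∀ i, idxPar (pr i) = idxPar i) {p q : ℕ} {f g : O F m n}
    (hf : f ∈ Hm F m n p) (hg : g ∈ Hm F m n q) (h : O F m n) :
    P2 r pr p q f g h = (-1 : F) ^ (p * q) • P2 r pr q p g f h := by
  rw [P2, P2, Finset.sum_comm, Finset.smul_sum]
  refine Finset.sum_congr rfl fun j _ => ?_
  rw [Finset.smul_sum]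
  refine Finset.sum_congr rfl fun i _ => ?_
  rw [supercomm (pd_mem i hf) (pd_mem j hg), pd_comm (pr i), hpar, hpar]
  simp only [map_smul, LinearMap.smul_apply, smul_smul]
  congr 1
  simp only [cf]
  have : (-1 : F) ^ (idxPar i * (q + idxPar j) + (idxPar i * idxPar j +
      (p + idxPar i) * (q + idxPar j))) =
      (-1) ^ (p * q + idxPar j * (p + idxPar i)) := by
    apply neg_pow_congr
    simp only [Nat.even_add, Nat.even_mul]
    by_cases h1 : Even p <;> by_cases h2 : Even q <;> by_cases h3 : Even (idxPar i) <;>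
      by_cases h4 : Even (idxPar j) <;> simp [h1, h2, h3, h4]
  simp only [pow_add] at this
  linear_combination ((tau r i : ℤ) : F) * (-1 : F) ^ (idxPar i * p) *
    (((tau r j : ℤ) : F) * (-1 : F) ^ (idxPar j * q)) * this

theorem rhs_eq (hpar : ∀ i, idxPar (pr i) = idxPar i) (hinv : Function.Involutive pr)
    (htau : ∀ i, ((tau r (pr i) : ℤ) : F) = - (-1) ^ idxPar i * ((tau r i : ℤ) : F))
    {p q : ℕ} {f g : O F m n}
    (hf : f ∈ Hm F m n p) (hg : g ∈ Hm F m n q) (h : O F m n) :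
    ∑ j, cf F r (p + q) j • mulO F
      (pd F j (∑ i, cf F r p i • mulO F (pd F i f) (pd F (pr i) g))) (pd F (pr j) h) =
    P1 r pr p q f g h - (-1 : F) ^ (p * q) • P1 r pr q p g f h := by
  have e : P1 r pr q p g f h = ∑ j, ∑ i, (cf F r q (pr i) * cf F r p j) •
      mulO F (mulO F (pd F (pr i) g) (pd F i (pd F j f))) (pd F (pr j) h) := by
    rw [P1, Finset.sum_comm]
    refine Finset.sum_congr rfl fun j _ => ?_
    refine Fintype.sum_equiv hinv.toPerm _ _ fun i => ?_
    simp only [Function.Involutive.coe_toPerm, hinv i]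
  rw [e, P1, Finset.sum_comm, Finset.smul_sum, ← Finset.sum_sub_distrib]
  refine Finset.sum_congr rfl fun j _ => ?_
  rw [map_sum, map_sum, LinearMap.sum_apply, Finset.smul_sum, Finset.smul_sum,
    ← Finset.sum_sub_distrib]
  refine Finset.sum_congr rfl fun i _ => ?_
  rw [map_smul, leib _ (pd_mem i hf), pd_comm j (pr i) g, hpar,
    supercomm (pd_mem (pr i) hg) (pd_mem i (pd_mem j hf)), pd_comm i j f, hpar]
  simp only [map_smul, map_add, LinearMap.smul_apply, LinearMap.add_apply, smul_add, smul_smul]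
  rw [add_comm, sub_eq_add_neg, ← neg_smul]
  congr 2
  · simp only [cf]
    have : (-1 : F) ^ (idxPar j * (p + q) + (idxPar j * (p + idxPar i) + idxPar j * idxPar i)) =
        (-1) ^ (idxPar j * q) := by
      apply neg_pow_congr
      simp only [Nat.even_add, Nat.even_mul]
      by_cases h1 : Even p <;> by_cases h2 : Even q <;> by_cases h3 : Even (idxPar i) <;>
        by_cases h4 : Even (idxPar j) <;> simp [h1, h2, h3, h4]
    simp only [pow_add] at this
    linear_combination ((tau r i : ℤ) : F) * (-1 : F) ^ (idxPar i * p) *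
      ((tau r j : ℤ) : F) * this
  · simp only [cf, htau, hpar]
    have : (-1 : F) ^ (idxPar j * (p + q) + idxPar i * p) =
        (-1) ^ (p * q + (idxPar i + (idxPar i * q + (idxPar j * p +
          ((q + idxPar i) * (p + idxPar j + idxPar i) + idxPar i * idxPar j))))) := by
      apply neg_pow_congr
      simp only [Nat.even_add, Nat.even_mul]
      by_cases h1 : Even p <;> by_cases h2 : Even q <;> by_cases h3 : Even (idxPar i) <;>
        by_cases h4 : Even (idxPar j) <;> simp [h1, h2, h3, h4]
    simp only [pow_add] at this
    linear_combination ((tau r i : ℤ) : F) * ((tau r j : ℤ) : F) * this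

theorem bracket_aux (hpar : ∀ i, idxPar (pr i) = idxPar i) (hinv : Function.Involutive pr)
    (htau : ∀ i, ((tau r (pr i) : ℤ) : F) = - (-1) ^ idxPar i * ((tau r i : ℤ) : F))
    (μ ν : Mono m n) :
    DHmono F r pr μ * DHmono F r pr ν
        - (-1 : F) ^ (μ.2.card * ν.2.card) • (DHmono F r pr ν * DHmono F r pr μ) =
      DH F r pr (DHmono F r pr μ (X F ν)) := by
  have hf := X_mem_self (F := F) μ
  have hg := X_mem_self (F := F) ν
  have hmem : DHmono F r pr μ (X F ν) ∈ Hm F m n (μ.2.card + ν.2.card) := by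
    rw [DHmono_eq]
    refine Submodule.sum_mem _ fun i _ => Submodule.smul_mem _ _ ?_
    have := mul_mem (pd_mem i hf) (pd_mem (pr i) hg)
    rw [hpar] at this
    refine Hm_mem (f := LinearMap.id) (fun ρ hρ => X_mem ?_) this
    grind
  refine LinearMap.ext fun h => ?_
  rw [DH_hom r pr hmem]
  simp only [LinearMap.sub_apply, LinearMap.smul_apply, Module.End.mul_apply, DHmono_eq]
  rw [rhs_eq r pr hpar hinv htau hf hg, prod_eq r pr hpar _ _ hg, prod_eq r pr hpar _ _ hf,
    P2_symm r pr hpar hf hg, smul_add]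
  abel

end Aux
end HamSup



open HamSup in
/-- `[D_H(f), D_H(g)] = D_H(D_H(f)(g))` for homogeneous `f, g`. -/
theorem bracket_DH_DH (F : Type) [Field F] (m n p : ℕ) (hp : p.Prime) (h3 : 3 < p)
    (hchar : ringChar F = p) (r s : ℕ) (hm : m = 2 * r) (hn : n = 2 * s ∨ n = 2 * s + 1)
    (t : Fin m → ℕ) (ht : ∀ i, 0 < t i)
    (prE : Fin m → Fin m)
    (hprE : ∀ i : Fin m, (prE i : ℕ) = if (i : ℕ) < r then (i : ℕ) + r else (i : ℕ) - r)
    (prO : Fin n → Fin n)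
    (hprO : ∀ j : Fin n, (prO j : ℕ) =
      if (j : ℕ) < s then (j : ℕ) + s else if (j : ℕ) < 2 * s then (j : ℕ) - s else (j : ℕ))
    (μ ν : Mono m n) :
    DHmono F r (Sum.map prE prO) μ * DHmono F r (Sum.map prE prO) ν
        - (-1 : F) ^ (μ.2.card * ν.2.card) • (DHmono F r (Sum.map prE prO) ν * DHmono F r (Sum.map prE prO) μ) =
      DH F r (Sum.map prE prO) (DHmono F r (Sum.map prE prO) μ (X F ν)) := by
  refine bracket_aux r (Sum.map prE prO) ?_ ?_ ?_ μ ν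
  · rintro (i | j) <;> rfl
  · rintro (i | j)
    · simp only [Sum.map_inl]
      congr 1
      apply Fin.ext
      rw [hprE, hprE]
      have := i.isLt
      split_ifs <;> omega
    · simp only [Sum.map_inr]
      congr 1
      apply Fin.ext
      rw [hprO, hprO]
      have := j.isLt
      split_ifs <;> omega
  · rintro (i | j)
    · simp only [Sum.map_inl, tau, Sum.elim_inl, hprE, idxPar]
      have := i.isLt
      split_ifs <;> first | omega | simp
    · simp [tau, idxPar]
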